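/- arXiv:2410.09497 — 3 statements merged into one kernel-verified Lean document; each statement's English description precedes it below -/
import Mathlib

section
/- Let L₁, M₁ be n×n real matrices and L₂, M₂ be m×m real matrices. Suppose S₁ is an n×n real matrix and λ₁ : Fin n → ℝ satisfy the generalized eigenvalue relation L₁ S₁ = M₁ S₁ Λ₁ with Λ₁ = diagonal(λ₁), and likewise L₂ S₂ = M₂ S₂ Λ₂ with Λ₂ = diagonal(λ₂). Then the Kronecker-sum matrix A = L₁ ⊗ M₂ + M₁ ⊗ L₂ satisfies A (S₁ ⊗ S₂) = (M₁ S₁ ⊗ M₂ S₂) · D, where D is the (nm)×(nm) diagonal matrix whose diagonal entry at index (i,j) is λ₁(i) + λ₂(j). -/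
open Matrix
open scoped Kronecker

theorem fast_diagonalization_kronecker_sum
    {n m : ℕ}
    (L₁ M₁ S₁ : Matrix (Fin n) (Fin n) ℝ)
    (L₂ M₂ S₂ : Matrix (Fin m) (Fin m) ℝ)
    (l₁ : Fin n → ℝ) (l₂ : Fin m → ℝ)
    (h₁ : L₁ * S₁ = M₁ * S₁ * Matrix.diagonal l₁)
    (h₂ : L₂ * S₂ = M₂ * S₂ * Matrix.diagonal l₂) :
    (L₁ ⊗ₖ M₂ + M₁ ⊗ₖ L₂) * (S₁ ⊗ₖ S₂) =
      ((M₁ * S₁) ⊗ₖ (M₂ * S₂)) *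
        Matrix.diagonal (fun p : Fin n × Fin m => l₁ p.1 + l₂ p.2) := by
  rw [Matrix.add_mul, ← mul_kronecker_mul, ← mul_kronecker_mul, h₁, h₂]
  ext ⟨i, j⟩ ⟨k, l⟩
  simp only [Matrix.add_apply, kronecker_apply, mul_diagonal]
  ring
end

section
/- Let L₁, M₁, S₁ be n×n real matrices, L₂, M₂, S₂ be m×m real matrices, and λ₁ : Fin n → ℝ, λ₂ : Fin m → ℝ. Assume the generalized eigenvalue relations L₁ S₁ = M₁ S₁ diagonal(λ₁) and L₂ S₂ = M₂ S₂ diagonal(λ₂), the M-orthonormality conditions S₁ᵀ M₁ S₁ = I and S₂ᵀ M₂ S₂ = I, and that λ₁(i) + λ₂(j) ≠ 0 for all i, j. Then the matrix A = L₁ ⊗ M₂ + M₁ ⊗ L₂ is invertible, and its inverse is (S₁ ⊗ S₂) · D⁻¹ · (S₁ᵀ ⊗ S₂ᵀ), where D⁻¹ is the diagonal matrix whose diagonal entry at index (i,j) is (λ₁(i) + λ₂(j))⁻¹. -/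
open Matrix
open scoped Kronecker

theorem fast_diagonalization_inverse
    {n m : ℕ}
    (L₁ M₁ S₁ : Matrix (Fin n) (Fin n) ℝ)
    (L₂ M₂ S₂ : Matrix (Fin m) (Fin m) ℝ)
    (l₁ : Fin n → ℝ) (l₂ : Fin m → ℝ)
    (h₁ : L₁ * S₁ = M₁ * S₁ * Matrix.diagonal l₁)
    (h₂ : L₂ * S₂ = M₂ * S₂ * Matrix.diagonal l₂)
    (ho₁ : S₁ᵀ * M₁ * S₁ = 1)
    (ho₂ : S₂ᵀ * M₂ * S₂ = 1)
    (hl : ∀ (i : Fin n) (j : Fin m), l₁ i + l₂ j ≠ 0) :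
    IsUnit (L₁ ⊗ₖ M₂ + M₁ ⊗ₖ L₂) ∧
      (L₁ ⊗ₖ M₂ + M₁ ⊗ₖ L₂)⁻¹ =
        (S₁ ⊗ₖ S₂) *
          Matrix.diagonal (fun p : Fin n × Fin m => (l₁ p.1 + l₂ p.2)⁻¹) *
          (S₁ᵀ ⊗ₖ S₂ᵀ) := by
  have hr₁ : M₁ * S₁ * S₁ᵀ = 1 := mul_eq_one_comm.mp (by rw [← Matrix.mul_assoc, ho₁])
  have hr₂ : M₂ * S₂ * S₂ᵀ = 1 := mul_eq_one_comm.mp (by rw [← Matrix.mul_assoc, ho₂])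
  have hA : (L₁ ⊗ₖ M₂ + M₁ ⊗ₖ L₂) * (S₁ ⊗ₖ S₂) =
      ((M₁ * S₁) ⊗ₖ (M₂ * S₂)) *
        Matrix.diagonal (fun p : Fin n × Fin m => l₁ p.1 + l₂ p.2) := by
    rw [Matrix.add_mul, ← mul_kronecker_mul, ← mul_kronecker_mul, h₁, h₂]
    ext ⟨i, j⟩ ⟨k, l⟩
    simp only [Matrix.add_apply, kroneckerMap_apply, mul_diagonal]
    ring
  have hD : Matrix.diagonal (fun p : Fin n × Fin m => l₁ p.1 + l₂ p.2) *
      Matrix.diagonal (fun p : Fin n × Fin m => (l₁ p.1 + l₂ p.2)⁻¹) = 1 := by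
    simp [diagonal_mul_diagonal, hl]
  have hinv : (L₁ ⊗ₖ M₂ + M₁ ⊗ₖ L₂) * ((S₁ ⊗ₖ S₂) *
      Matrix.diagonal (fun p : Fin n × Fin m => (l₁ p.1 + l₂ p.2)⁻¹) *
      (S₁ᵀ ⊗ₖ S₂ᵀ)) = 1 := by
    rw [← Matrix.mul_assoc, ← Matrix.mul_assoc, hA, Matrix.mul_assoc _ (diagonal _) (diagonal _), hD,
      Matrix.mul_one, ← mul_kronecker_mul, hr₁, hr₂, one_kronecker_one]
  exact ⟨IsUnit.of_mul_eq_one _ hinv, inv_eq_right_inv hinv⟩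
end

section
/- Let A be a symmetric n×n real matrix and R : Fin m → (k×n real matrices) a family of restriction matrices such that each local matrix A_j = R j ⬝ A ⬝ (R j)ᵀ is invertible, and define P j = (R j)ᵀ ⬝ (A_j)⁻¹ ⬝ (R j) ⬝ A. If R i ⬝ A ⬝ (R j)ᵀ = 0 for all i ≠ j, then the ordered product ∏_{j=0}^{m−1} (I − P j) equals I − ∑_{j=0}^{m−1} P j; in particular the product is independent of the ordering of the factors. -/
open Matrix

/-- If the products of distinct members of a finite family in a ring vanish, then the ordered
product of the factors `1 - p j` is `1` minus the sum of the family. -/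
theorem List.prod_ofFn_one_sub_of_pairwise_mul_eq_zero {S : Type*} [Ring S] {m : ℕ}
    (p : Fin m → S) (hp : _root_.Pairwise fun i j => p i * p j = 0) :
    (List.ofFn fun j => 1 - p j).prod = 1 - ∑ j, p j := by
  induction m with
  | zero => simp
  | succ m ih =>
    have h_tail : p 0 * ∑ j : Fin m, p j.succ = 0 := by
      rw [Finset.mul_sum]
      exact Finset.sum_eq_zero fun j _ => hp (Fin.succ_ne_zero j).symm
    rw [List.ofFn_succ, List.prod_cons,
      ih (fun j => p j.succ) fun i j hij => hp ((Fin.succ_injective m).ne hij),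
      Fin.sum_univ_succ, sub_mul, one_mul, mul_sub, mul_one, h_tail]
    abel

theorem multiplicative_equals_additive_within_color
    {n k m : ℕ}
    (A : Matrix (Fin n) (Fin n) ℝ) (hA : A.IsSymm)
    (R : Fin m → Matrix (Fin k) (Fin n) ℝ)
    (hAj : ∀ j, IsUnit (R j * A * (R j)ᵀ))
    (P : Fin m → Matrix (Fin n) (Fin n) ℝ)
    (hP : ∀ j, P j = (R j)ᵀ * (R j * A * (R j)ᵀ)⁻¹ * R j * A)
    (horth : ∀ i j, i ≠ j → R i * A * (R j)ᵀ = 0) :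
    (List.ofFn fun j : Fin m => (1 : Matrix (Fin n) (Fin n) ℝ) - P j).prod =
      1 - ∑ j : Fin m, P j := by
  refine List.prod_ofFn_one_sub_of_pairwise_mul_eq_zero P fun i j hij => ?_
  calc P i * P j
      = (R i)ᵀ * (R i * A * (R i)ᵀ)⁻¹ * (R i * A * (R j)ᵀ) *
          ((R j * A * (R j)ᵀ)⁻¹ * R j * A) := by
        rw [hP i, hP j]
        simp only [Matrix.mul_assoc]
    _ = 0 := by rw [horth i j hij, Matrix.mul_zero, Matrix.zero_mul]
end
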